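/- Fix a quiver with vertex set I, adjacency matrix Q = (Q_{ij}) counting edges from i to j, dimension vectors v = v1 + v2 and w = w1 + w2 in ℕ^I. Write Chern root variables s^{(1)}_{i,a} (a = 1,…,(v1)_i) and s^{(2)}_{i,b} (b = 1,…,(v2)_i) for each vertex i, equivariant parameters u^{(1)}_{i,c}, u^{(2)}_{i,c} for the framings, and h. Define the kernel e(T*Rep(v,w)[−1]) as the product, over every edge e of Q, of Π_{a,b} (s^{(1)}_{h(e),a} − s^{(2)}_{t(e),b}) · Π_{a,b} (h + s^{(1)}_{t(e),a} − s^{(2)}_{h(e),b}), times, for every vertex i, the framing factors Π_{a,c} (u^{(1)}_{i,c} − s^{(2)}_{i,a}) · Π_{a,c} (h + s^{(1)}_{i,a} − u^{(2)}_{i,c}); and define e(g_v[−1]) = Π_{i ∈ I} Π_{a,b} (s^{(1)}_{i,a} − s^{(2)}_{i,b}). Then for f1, f2 polynomials symmetric in each group of variables s^{(1)}_{i,•} resp. s^{(2)}_{i,•}, the product m(f1, f2) := Shuffle( e(T*Rep(v,w)[−1]) · f1 · f2 / e(g_v[−1]) ), where Shuffle symmetrizes over shuffles of the variables at each vertex independently,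 is a polynomial symmetric in each full group of vertex variables, and this operation defines an associative product. -/

import Mathlib

open Equiv MvPolynomial

open scoped Classical

/-- An `(n1, n2)`-shuffle. -/
def IsShuffle (n1 n2 : ℕ) (σ : Equiv.Perm (Fin (n1 + n2))) : Prop :=
  StrictMono (fun i : Fin n1 => σ (Fin.castAdd n2 i)) ∧
  StrictMono (fun j : Fin n2 => σ (Fin.natAdd n1 j))

variable {k : Type*} [CommRing k] [IsDomain k]
variable {I : Type*} [Fintype I] [DecidableEq I]

/-- The set of Chern root variables for a dimension vector `v : I → ℕ`:
one variable `s_{i,a}` for each vertex `i` and `a = 1, …, v_i`. -/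
abbrev QVars (I : Type*) (v : I → ℕ) : Type _ := Σ i : I, Fin (v i)

/-- The tautological (Chern-root) polynomial ring for dimension vector `v`. -/
abbrev QPoly (k I : Type*) [CommRing k] (v : I → ℕ) : Type _ :=
  MvPolynomial (QVars I v) k

/-- Rational functions in the Chern roots. -/
abbrev QFrac (k I : Type*) [CommRing k] [IsDomain k] (v : I → ℕ) : Type _ :=
  FractionRing (QPoly k I v)

/-- The field homomorphism between fraction fields of Chern-root rings induced by an
injective relabelling of the variables. -/
noncomputable def qFracMap {v v' : I → ℕ} (e : QVars I v → QVars I v')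
    (he : Function.Injective e) : QFrac k I v →+* QFrac k I v' :=
  IsFractionRing.lift
    (g := (algebraMap (QPoly k I v') (QFrac k I v')).comp
      (rename e : QPoly k I v →ₐ[k] QPoly k I v').toRingHom)
    (by
      exact (IsFractionRing.injective (QPoly k I v') (QFrac k I v')).comp
        (rename_injective e he))

/-- First-block inclusion of variables, `s^{(1)}_{i,a} ↦ s_{i,a}`. -/
def emb1 (v1 v2 : I → ℕ) : QVars I v1 → QVars I (v1 + v2) :=
  fun x => ⟨x.1, Fin.castAdd (v2 x.1) x.2⟩

/-- Second-block inclusion of variables, `s^{(2)}_{i,b} ↦ s_{i, v1_i + b}`. -/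
def emb2 (v1 v2 : I → ℕ) : QVars I v2 → QVars I (v1 + v2) :=
  fun x => ⟨x.1, Fin.natAdd (v1 x.1) x.2⟩

lemma emb1_injective (v1 v2 : I → ℕ) : Function.Injective (emb1 (I := I) v1 v2) := by
  intro x y hab
  have h1 := congrArg Sigma.fst hab
  rcases x with ⟨i, a⟩
  rcases y with ⟨j, b⟩
  simp only [emb1] at h1
  subst h1
  have h2 : Fin.castAdd (v2 i) a = Fin.castAdd (v2 i) b := by
    simpa [emb1] using hab
  have h3 : a = b := Fin.castAdd_injective _ _ h2
  subst h3
  rfl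

lemma emb2_injective (v1 v2 : I → ℕ) : Function.Injective (emb2 (I := I) v1 v2) := by
  intro x y hab
  have h1 := congrArg Sigma.fst hab
  rcases x with ⟨i, a⟩
  rcases y with ⟨j, b⟩
  simp only [emb2] at h1
  subst h1
  have h2 : Fin.natAdd (v1 i) a = Fin.natAdd (v1 i) b := by
    simpa [emb2] using hab
  have h3 : a = b := Fin.ext (Nat.add_left_cancel (congrArg Fin.val h2))
  subst h3
  rfl

/-- The Euler class `e(T*Rep(v,w)[-1])`: the product, over all edges of the quiver (with
`Q i j` edges from `i` to `j`), of
`Π_{a,b} (s^{(1)}_{h(e),a} − s^{(2)}_{t(e),b}) · Π_{a,b} (h + s^{(1)}_{t(e),a} − s^{(2)}_{h(e),b})`,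
times, for every vertex `i`, the framing factors
`Π_{b,c} (u^{(1)}_{i,c} − s^{(2)}_{i,b}) · Π_{a,c} (h + s^{(1)}_{i,a} − u^{(2)}_{i,c})`. -/
noncomputable def eulerKernel (Q : I → I → ℕ) (h : k) (v1 v2 w1 w2 : I → ℕ)
    (u1 : ∀ i, Fin (w1 i) → k) (u2 : ∀ i, Fin (w2 i) → k) : QPoly k I (v1 + v2) :=
  (∏ i : I, ∏ j : I,
    ((∏ a : Fin (v1 j), ∏ b : Fin (v2 i),
        (X (⟨j, Fin.castAdd (v2 j) a⟩ : QVars I (v1 + v2)) -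
          X (⟨i, Fin.natAdd (v1 i) b⟩ : QVars I (v1 + v2)))) *
      ∏ a : Fin (v1 i), ∏ b : Fin (v2 j),
        (C h + X (⟨i, Fin.castAdd (v2 i) a⟩ : QVars I (v1 + v2)) -
          X (⟨j, Fin.natAdd (v1 j) b⟩ : QVars I (v1 + v2)))) ^ Q i j) *
  ∏ i : I,
    ((∏ b : Fin (v2 i), ∏ c : Fin (w1 i),
        (C (u1 i c) - X (⟨i, Fin.natAdd (v1 i) b⟩ : QVars I (v1 + v2)))) *
      ∏ a : Fin (v1 i), ∏ c : Fin (w2 i),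
        (C h + X (⟨i, Fin.castAdd (v2 i) a⟩ : QVars I (v1 + v2)) - C (u2 i c)))

/-- The Euler class `e(g_v[-1]) = Π_i Π_{a,b} (s^{(1)}_{i,a} − s^{(2)}_{i,b})`. -/
noncomputable def gNegKernel (v1 v2 : I → ℕ) : QPoly k I (v1 + v2) :=
  ∏ i : I, ∏ a : Fin (v1 i), ∏ b : Fin (v2 i),
    (X (⟨i, Fin.castAdd (v2 i) a⟩ : QVars I (v1 + v2)) -
      X (⟨i, Fin.natAdd (v1 i) b⟩ : QVars I (v1 + v2)))

/-- The framed CoHA multiplication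
`m(f1, f2) = Shuffle( e(T*Rep(v,w)[-1]) · f1 · f2 / e(g_v[-1]) )`, where the shuffle
symmetrizes over `((v1)_i, (v2)_i)`-shuffles of the variables at each vertex `i`
independently. -/
noncomputable def cohaMul (Q : I → I → ℕ) (h : k) (v1 v2 w1 w2 : I → ℕ)
    (u1 : ∀ i, Fin (w1 i) → k) (u2 : ∀ i, Fin (w2 i) → k)
    (f1 : QPoly k I v1) (f2 : QPoly k I v2) : QFrac k I (v1 + v2) :=
  ∑ τ : ∀ i : I, Equiv.Perm (Fin (v1 i + v2 i)),
    if ∀ i, IsShuffle (v1 i) (v2 i) (τ i) then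
      qFracMap (⇑(Equiv.sigmaCongrRight τ)) (Equiv.sigmaCongrRight τ).injective
        (algebraMap (QPoly k I (v1 + v2)) (QFrac k I (v1 + v2))
            (eulerKernel Q h v1 v2 w1 w2 u1 u2 *
              rename (emb1 v1 v2) f1 * rename (emb2 v1 v2) f2) /
          algebraMap (QPoly k I (v1 + v2)) (QFrac k I (v1 + v2)) (gNegKernel v1 v2))
    else 0

/-- A polynomial symmetric in each full group of vertex variables, i.e. invariant under
`Π_i S_{v_i}`. -/
def VertexSymm {v : I → ℕ} (f : QPoly k I v) : Prop :=
  ∀ τ : ∀ i : I, Equiv.Perm (Fin (v i)),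
    rename (⇑(Equiv.sigmaCongrRight τ)) f = f


/-! ### Combinatorics of shuffles -/

/-- The block permutation `η1 ⊕ η2`. -/
def blk {n1 n2 : ℕ} (η1 : Equiv.Perm (Fin n1)) (η2 : Equiv.Perm (Fin n2)) :
    Equiv.Perm (Fin (n1 + n2)) :=
  (finSumFinEquiv.symm.trans (Equiv.sumCongr η1 η2)).trans finSumFinEquiv

@[simp] lemma blk_castAdd {n1 n2 : ℕ} (η1 : Equiv.Perm (Fin n1)) (η2 : Equiv.Perm (Fin n2))
    (a : Fin n1) : blk η1 η2 (Fin.castAdd n2 a) = Fin.castAdd n2 (η1 a) := by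
  simp [blk]

@[simp] lemma blk_natAdd {n1 n2 : ℕ} (η1 : Equiv.Perm (Fin n1)) (η2 : Equiv.Perm (Fin n2))
    (a : Fin n2) : blk η1 η2 (Fin.natAdd n1 a) = Fin.natAdd n1 (η2 a) := by
  simp [blk]

lemma perm_ext_blk {n1 n2 : ℕ} {α : Type*} {f g : Fin (n1 + n2) → α}
    (h1 : ∀ a, f (Fin.castAdd n2 a) = g (Fin.castAdd n2 a))
    (h2 : ∀ a, f (Fin.natAdd n1 a) = g (Fin.natAdd n1 a)) : f = g := by
  funext x
  induction x using Fin.addCases with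
  | left a => exact h1 a
  | right a => exact h2 a

lemma blk_mul {n1 n2 : ℕ} (η1 μ1 : Equiv.Perm (Fin n1)) (η2 μ2 : Equiv.Perm (Fin n2)) :
    blk η1 η2 * blk μ1 μ2 = blk (η1 * μ1) (η2 * μ2) := by
  apply Equiv.coe_fn_injective
  apply perm_ext_blk <;> intro a <;> simp

lemma blk_one {n1 n2 : ℕ} : blk (1 : Equiv.Perm (Fin n1)) (1 : Equiv.Perm (Fin n2)) = 1 := by
  apply Equiv.coe_fn_injective
  apply perm_ext_blk <;> intro a <;> simp

lemma blk_inv {n1 n2 : ℕ} (η1 : Equiv.Perm (Fin n1)) (η2 : Equiv.Perm (Fin n2)) :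
    (blk η1 η2)⁻¹ = blk η1⁻¹ η2⁻¹ := by
  rw [inv_eq_iff_mul_eq_one, blk_mul]
  simp [blk_one]

lemma exists_shuffle {n1 n2 : ℕ} (ρ : Equiv.Perm (Fin (n1 + n2))) :
    ∃ σ, IsShuffle n1 n2 σ ∧ ∃ η1 η2, ρ = σ * blk η1 η2 := by
  have i1 : Function.Injective (fun a => ρ (Fin.castAdd n2 a)) :=
    ρ.injective.comp (Fin.castAdd_injective _ _)
  have i2 : Function.Injective (fun a => ρ (Fin.natAdd n1 a)) :=
    ρ.injective.comp (Fin.natAdd_injective _ _)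
  refine ⟨ρ * blk (Tuple.sort (fun a => ρ (Fin.castAdd n2 a)))
    (Tuple.sort (fun a => ρ (Fin.natAdd n1 a))), ⟨?_, ?_⟩,
    (Tuple.sort (fun a => ρ (Fin.castAdd n2 a)))⁻¹,
    (Tuple.sort (fun a => ρ (Fin.natAdd n1 a)))⁻¹, ?_⟩
  · have := (Tuple.monotone_sort (fun a => ρ (Fin.castAdd n2 a))).strictMono_of_injective
      (i1.comp (Equiv.injective _))
    simpa [Function.comp_def] using this
  · have := (Tuple.monotone_sort (fun a => ρ (Fin.natAdd n1 a))).strictMono_of_injective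
      (i2.comp (Equiv.injective _))
    simpa [Function.comp_def] using this
  · rw [mul_assoc, blk_mul]
    simp [blk_one]

lemma perm_strictMono_eq_one {n : ℕ} (μ : Equiv.Perm (Fin n)) (h : StrictMono μ) : μ = 1 := by
  have : (StrictMono.orderIsoOfSurjective μ h μ.surjective) = OrderIso.refl _ :=
    Subsingleton.elim _ _
  ext x
  have := congrArg (fun e => e x) this
  simpa using congrArg Fin.val this

lemma shuffle_unique_aux {n1 n2 : ℕ} {σ σ' : Equiv.Perm (Fin (n1 + n2))}
    (h : IsShuffle n1 n2 σ) (h' : IsShuffle n1 n2 σ') {μ1 μ2}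
    (e : σ = σ' * blk μ1 μ2) : μ1 = 1 ∧ μ2 = 1 := by
  constructor <;> apply perm_strictMono_eq_one <;> intro a b hab
  · have := h.1 hab
    simp only [e, Equiv.Perm.mul_apply, blk_castAdd] at this
    exact h'.1.lt_iff_lt.1 this
  · have := h.2 hab
    simp only [e, Equiv.Perm.mul_apply, blk_natAdd] at this
    exact h'.2.lt_iff_lt.1 this

lemma shuffle_unique {n1 n2 : ℕ} {σ σ' : Equiv.Perm (Fin (n1 + n2))}
    (h : IsShuffle n1 n2 σ) (h' : IsShuffle n1 n2 σ') {η1 η2 μ1 μ2}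
    (e : σ * blk η1 η2 = σ' * blk μ1 μ2) : σ = σ' ∧ η1 = μ1 ∧ η2 = μ2 := by
  have e' : σ = σ' * blk (μ1 * η1⁻¹) (μ2 * η2⁻¹) := by
    rw [← blk_mul, ← mul_assoc, ← e, mul_assoc, blk_mul]
    simp [blk_one]
  obtain ⟨h1, h2⟩ := shuffle_unique_aux h h' e'
  refine ⟨?_, (mul_inv_eq_one.1 h1).symm, (mul_inv_eq_one.1 h2).symm⟩
  rw [e', h1, h2, blk_one, mul_one]

/-- three-block shuffles -/
def IsSh3 (n1 n2 n3 : ℕ) (ρ : Equiv.Perm (Fin (n1 + (n2 + n3)))) : Prop :=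
  StrictMono (fun a : Fin n1 => ρ (Fin.castAdd (n2 + n3) a)) ∧
  StrictMono (fun a : Fin n2 => ρ (Fin.natAdd n1 (Fin.castAdd n3 a))) ∧
  StrictMono (fun a : Fin n3 => ρ (Fin.natAdd n1 (Fin.natAdd n2 a)))

lemma castAdd_strictMono {m n : ℕ} {α : Type*} [Preorder α] (f : Fin (m + n) → α)
    (h : StrictMono f) : StrictMono (fun a : Fin m => f (Fin.castAdd n a)) :=
  h.comp (Fin.strictMono_castAdd _)

lemma natAdd_strictMono {m n : ℕ} {α : Type*} [Preorder α] (f : Fin (m + n) → α)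
    (h : StrictMono f) : StrictMono (fun a : Fin n => f (Fin.natAdd m a)) :=
  h.comp (Fin.strictMono_natAdd _)

lemma sh3_right {n1 n2 n3 : ℕ} {σ : Equiv.Perm (Fin (n1 + (n2 + n3)))}
    (h : IsShuffle n1 (n2 + n3) σ) {τ : Equiv.Perm (Fin (n2 + n3))} (h' : IsShuffle n2 n3 τ) :
    IsSh3 n1 n2 n3 (σ * blk 1 τ) := by
  refine ⟨?_, ?_, ?_⟩
  · simpa using h.1
  · simpa [Function.comp_def] using h.2.comp h'.1
  · simpa [Function.comp_def] using h.2.comp h'.2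

lemma sh3_right_surj {n1 n2 n3 : ℕ} {ρ : Equiv.Perm (Fin (n1 + (n2 + n3)))}
    (h : IsSh3 n1 n2 n3 ρ) : ∃ σ τ, IsShuffle n1 (n2 + n3) σ ∧ IsShuffle n2 n3 τ ∧
      σ * blk 1 τ = ρ := by
  obtain ⟨σ, hσ, η1, η2, rfl⟩ := exists_shuffle ρ
  have h1 : η1 = 1 := by
    apply perm_strictMono_eq_one
    intro a b hab
    have := h.1 hab
    simp only [Equiv.Perm.mul_apply, blk_castAdd] at this
    exact hσ.1.lt_iff_lt.1 this
  subst h1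
  refine ⟨σ, η2, hσ, ⟨?_, ?_⟩, rfl⟩
  · intro a b hab
    have := h.2.1 hab
    simp only [Equiv.Perm.mul_apply, blk_natAdd] at this
    exact hσ.2.lt_iff_lt.1 this
  · intro a b hab
    have := h.2.2 hab
    simp only [Equiv.Perm.mul_apply, blk_natAdd] at this
    exact hσ.2.lt_iff_lt.1 this

/-- conjugation by the associativity identification -/
def asc {n1 n2 n3 : ℕ} (ρ : Equiv.Perm (Fin (n1 + n2 + n3))) :
    Equiv.Perm (Fin (n1 + (n2 + n3))) :=
  (finCongr (Nat.add_assoc n1 n2 n3)).permCongr ρ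

lemma fc1 {n1 n2 n3 : ℕ} (a : Fin n1) : finCongr (Nat.add_assoc n1 n2 n3)
    (Fin.castAdd n3 (Fin.castAdd n2 a)) = Fin.castAdd (n2 + n3) a := rfl
lemma fc2 {n1 n2 n3 : ℕ} (a : Fin n2) : finCongr (Nat.add_assoc n1 n2 n3)
    (Fin.castAdd n3 (Fin.natAdd n1 a)) = Fin.natAdd n1 (Fin.castAdd n3 a) := rfl
lemma fc3 {n1 n2 n3 : ℕ} (a : Fin n3) : finCongr (Nat.add_assoc n1 n2 n3)
    (Fin.natAdd (n1 + n2) a) = Fin.natAdd n1 (Fin.natAdd n2 a) := by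
  ext; simp [Nat.add_assoc]

lemma isSh3_asc {n1 n2 n3 : ℕ} (ρ : Equiv.Perm (Fin (n1 + n2 + n3))) :
    IsSh3 n1 n2 n3 (asc ρ) ↔
      (StrictMono (fun a : Fin n1 => ρ (Fin.castAdd n3 (Fin.castAdd n2 a))) ∧
      StrictMono (fun a : Fin n2 => ρ (Fin.castAdd n3 (Fin.natAdd n1 a))) ∧
      StrictMono (fun a : Fin n3 => ρ (Fin.natAdd (n1 + n2) a))) := by
  unfold IsSh3
  simp only [← fc1 (n2 := n2), ← fc2, ← fc3]
  simp only [asc, Equiv.permCongr_apply, Equiv.symm_apply_apply]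
  rfl

lemma sh3_left {n1 n2 n3 : ℕ} {σ : Equiv.Perm (Fin (n1 + n2 + n3))}
    (h : IsShuffle (n1 + n2) n3 σ) {τ : Equiv.Perm (Fin (n1 + n2))} (h' : IsShuffle n1 n2 τ) :
    IsSh3 n1 n2 n3 (asc (σ * blk τ 1)) := by
  rw [isSh3_asc]
  refine ⟨?_, ?_, ?_⟩
  · simpa [Function.comp_def] using h.1.comp h'.1
  · simpa [Function.comp_def] using h.1.comp h'.2
  · simpa using h.2

lemma sh3_left_surj {n1 n2 n3 : ℕ} {ρ : Equiv.Perm (Fin (n1 + (n2 + n3)))}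
    (h : IsSh3 n1 n2 n3 ρ) : ∃ σ τ, IsShuffle (n1 + n2) n3 σ ∧ IsShuffle n1 n2 τ ∧
      asc (σ * blk τ 1) = ρ := by
  obtain ⟨ρ, rfl⟩ := (finCongr (Nat.add_assoc n1 n2 n3)).permCongr.surjective ρ
  rw [← asc, isSh3_asc] at h
  obtain ⟨σ, hσ, η1, η2, rfl⟩ := exists_shuffle ρ
  have h1 : η2 = 1 := by
    apply perm_strictMono_eq_one
    intro a b hab
    have := h.2.2 hab
    simp only [Equiv.Perm.mul_apply, blk_natAdd] at this
    exact hσ.2.lt_iff_lt.1 this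
  subst h1
  refine ⟨σ, η1, hσ, ⟨?_, ?_⟩, rfl⟩
  · intro a b hab
    have := h.1 hab
    simp only [Equiv.Perm.mul_apply, blk_castAdd] at this
    exact hσ.1.lt_iff_lt.1 this
  · intro a b hab
    have := h.2.1 hab
    simp only [Equiv.Perm.mul_apply, blk_castAdd] at this
    exact hσ.1.lt_iff_lt.1 this

/-- The finite set of vertexwise shuffles. -/
noncomputable def shs (v1 v2 : I → ℕ) : Finset (∀ i : I, Equiv.Perm (Fin (v1 i + v2 i))) :=
  Finset.univ.filter fun τ => ∀ i, IsShuffle (v1 i) (v2 i) (τ i)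

/-- The finite set of vertexwise three-block shuffles. -/
noncomputable def shs3 (v1 v2 v3 : I → ℕ) :
    Finset (∀ i : I, Equiv.Perm (Fin (v1 i + (v2 i + v3 i)))) :=
  Finset.univ.filter fun τ => ∀ i, IsSh3 (v1 i) (v2 i) (v3 i) (τ i)

lemma mem_shs {v1 v2 : I → ℕ} {τ} :
    τ ∈ shs v1 v2 ↔ ∀ i, IsShuffle (v1 i) (v2 i) (τ i) := by simp [shs]

lemma mem_shs3 {v1 v2 v3 : I → ℕ} {τ} :
    τ ∈ shs3 v1 v2 v3 ↔ ∀ i, IsSh3 (v1 i) (v2 i) (v3 i) (τ i) := by simp [shs3]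

lemma sum_right {M : Type*} [AddCommMonoid M] (v1 v2 v3 : I → ℕ)
    (T : (∀ i : I, Equiv.Perm (Fin (v1 i + (v2 i + v3 i)))) → M) :
    ∑ σ ∈ shs v1 (v2 + v3), ∑ τ ∈ shs v2 v3, T (fun i => σ i * blk 1 (τ i)) =
      ∑ ρ ∈ shs3 v1 v2 v3, T ρ := by
  rw [← Finset.sum_product']
  refine Finset.sum_bij (fun p _ => fun i => p.1 i * blk 1 (p.2 i)) ?_ ?_ ?_ ?_
  · rintro ⟨σ, τ⟩ h
    rw [Finset.mem_product, mem_shs, mem_shs] at h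
    rw [mem_shs3]
    exact fun i => sh3_right (h.1 i) (h.2 i)
  · rintro ⟨σ, τ⟩ h ⟨σ', τ'⟩ h' e
    rw [Finset.mem_product, mem_shs, mem_shs] at h h'
    have := fun i => shuffle_unique (h.1 i) (h'.1 i) (congrFun e i)
    exact Prod.ext (funext fun i => (this i).1) (funext fun i => (this i).2.2)
  · intro ρ h
    rw [mem_shs3] at h
    choose σ τ h1 h2 h3 using fun i => sh3_right_surj (h i)
    exact ⟨⟨σ, τ⟩, by rw [Finset.mem_product, mem_shs, mem_shs]; exact ⟨h1, h2⟩, funext h3⟩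
  · intros; rfl

lemma sum_left {M : Type*} [AddCommMonoid M] (v1 v2 v3 : I → ℕ)
    (T : (∀ i : I, Equiv.Perm (Fin (v1 i + (v2 i + v3 i)))) → M) :
    ∑ σ ∈ shs (v1 + v2) v3, ∑ τ ∈ shs v1 v2, T (fun i => asc (σ i * blk (τ i) 1)) =
      ∑ ρ ∈ shs3 v1 v2 v3, T ρ := by
  rw [← Finset.sum_product']
  refine Finset.sum_bij (fun p _ => fun i => asc (p.1 i * blk (p.2 i) 1)) ?_ ?_ ?_ ?_
  · rintro ⟨σ, τ⟩ h
    rw [Finset.mem_product, mem_shs, mem_shs] at h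
    rw [mem_shs3]
    exact fun i => sh3_left (h.1 i) (h.2 i)
  · rintro ⟨σ, τ⟩ h ⟨σ', τ'⟩ h' e
    rw [Finset.mem_product, mem_shs, mem_shs] at h h'
    have := fun i => shuffle_unique (h.1 i) (h'.1 i)
      ((finCongr (Nat.add_assoc (v1 i) (v2 i) (v3 i))).permCongr.injective (congrFun e i))
    exact Prod.ext (funext fun i => (this i).1) (funext fun i => (this i).2.1)
  · intro ρ h
    rw [mem_shs3] at h
    choose σ τ h1 h2 h3 using fun i => sh3_left_surj (h i)
    exact ⟨⟨σ, τ⟩, by rw [Finset.mem_product, mem_shs, mem_shs]; exact ⟨h1, h2⟩, funext h3⟩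
  · intros; rfl

set_option linter.unusedSectionVars false

lemma prod2_perm {α β M : Type*} [Fintype α] [Fintype β] [CommMonoid M] (e : Equiv.Perm α)
    (e' : Equiv.Perm β) (f : α → β → M) : ∏ a, ∏ b, f (e a) (e' b) = ∏ a, ∏ b, f a b := by
  rw [Equiv.prod_comp e (fun a => ∏ b, f a (e' b))]
  exact Finset.prod_congr rfl fun a _ => Equiv.prod_comp e' (f a)

/-! ### Relabelling maps -/

lemma qFracMap_algebraMap {v v' : I → ℕ} (e : QVars I v → QVars I v')
    (he : Function.Injective e) (f : QPoly k I v) :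
    qFracMap e he (algebraMap (QPoly k I v) (QFrac k I v) f) =
      algebraMap (QPoly k I v') (QFrac k I v') (rename e f) := by
  unfold qFracMap
  rw [IsFractionRing.lift_algebraMap]
  rfl

lemma qFracMap_div {v v' : I → ℕ} (e : QVars I v → QVars I v')
    (he : Function.Injective e) (f g : QPoly k I v) :
    qFracMap e he (algebraMap (QPoly k I v) (QFrac k I v) f /
        algebraMap (QPoly k I v) (QFrac k I v) g) =
      algebraMap (QPoly k I v') (QFrac k I v') (rename e f) /
        algebraMap (QPoly k I v') (QFrac k I v') (rename e g) := by
  rw [map_div₀, qFracMap_algebraMap, qFracMap_algebraMap]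

lemma qFracMap_comp {v v' v'' : I → ℕ} (e : QVars I v → QVars I v')
    (he : Function.Injective e) (e' : QVars I v' → QVars I v'')
    (he' : Function.Injective e') (e'' : QVars I v → QVars I v'')
    (he'' : Function.Injective e'') (hc : ∀ x, e' (e x) = e'' x) (z : QFrac k I v) :
    qFracMap e' he' (qFracMap e he z) = qFracMap e'' he'' z := by
  obtain ⟨a, b, -, rfl⟩ := IsFractionRing.div_surjective (A := QPoly k I v) z
  rw [qFracMap_div, qFracMap_div, qFracMap_div, rename_rename, rename_rename]
  have : e' ∘ e = e'' := funext hc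
  rw [this]

/-- The action of vertexwise permutations on rational functions. -/
noncomputable def act {v : I → ℕ} (τ : ∀ i : I, Equiv.Perm (Fin (v i))) :
    QFrac k I v →+* QFrac k I v :=
  qFracMap (⇑(Equiv.sigmaCongrRight τ)) (Equiv.sigmaCongrRight τ).injective

lemma act_act {v : I → ℕ} (τ σ : ∀ i : I, Equiv.Perm (Fin (v i))) (z : QFrac k I v) :
    act τ (act σ z) = act (fun i => τ i * σ i) z :=
  qFracMap_comp _ _ _ _ _ _ (fun _ => rfl) z

lemma act_div {v : I → ℕ} (τ : ∀ i : I, Equiv.Perm (Fin (v i))) (f g : QPoly k I v) :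
    act τ (algebraMap (QPoly k I v) (QFrac k I v) f /
        algebraMap (QPoly k I v) (QFrac k I v) g) =
      algebraMap (QPoly k I v) (QFrac k I v) (rename (⇑(Equiv.sigmaCongrRight τ)) f) /
        algebraMap (QPoly k I v) (QFrac k I v) (rename (⇑(Equiv.sigmaCongrRight τ)) g) :=
  qFracMap_div _ _ _ _

/-- Vertexwise block permutation. -/
def blkV {v1 v2 : I → ℕ} (η1 : ∀ i : I, Equiv.Perm (Fin (v1 i)))
    (η2 : ∀ i : I, Equiv.Perm (Fin (v2 i))) : ∀ i : I, Equiv.Perm (Fin ((v1 + v2) i)) :=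
  fun i => blk (η1 i) (η2 i)

lemma blkV_cast {v1 v2 : I → ℕ} (η1 : ∀ i : I, Equiv.Perm (Fin (v1 i)))
    (η2 : ∀ i : I, Equiv.Perm (Fin (v2 i))) (i : I) (a : Fin (v1 i)) :
    (Equiv.sigmaCongrRight (blkV η1 η2)) (⟨i, Fin.castAdd (v2 i) a⟩ : QVars I (v1 + v2)) =
      ⟨i, Fin.castAdd (v2 i) (η1 i a)⟩ :=
  congrArg (Sigma.mk (β := fun i => Fin ((v1 + v2) i)) i) (blk_castAdd (η1 i) (η2 i) a)

lemma blkV_nat {v1 v2 : I → ℕ} (η1 : ∀ i : I, Equiv.Perm (Fin (v1 i)))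
    (η2 : ∀ i : I, Equiv.Perm (Fin (v2 i))) (i : I) (a : Fin (v2 i)) :
    (Equiv.sigmaCongrRight (blkV η1 η2)) (⟨i, Fin.natAdd (v1 i) a⟩ : QVars I (v1 + v2)) =
      ⟨i, Fin.natAdd (v1 i) (η2 i a)⟩ :=
  congrArg (Sigma.mk (β := fun i => Fin ((v1 + v2) i)) i) (blk_natAdd (η1 i) (η2 i) a)

lemma eulerKernel_symm (Q : I → I → ℕ) (h : k) (v1 v2 w1 w2 : I → ℕ)
    (u1 : ∀ i, Fin (w1 i) → k) (u2 : ∀ i, Fin (w2 i) → k)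
    (η1 : ∀ i : I, Equiv.Perm (Fin (v1 i))) (η2 : ∀ i : I, Equiv.Perm (Fin (v2 i))) :
    rename (⇑(Equiv.sigmaCongrRight (blkV η1 η2))) (eulerKernel Q h v1 v2 w1 w2 u1 u2) =
      eulerKernel Q h v1 v2 w1 w2 u1 u2 := by
  unfold eulerKernel
  simp only [map_mul, map_prod, map_pow, map_sub, map_add, rename_X, rename_C, blkV_cast,
    blkV_nat]
  refine congrArg₂ _ ?_ ?_
  · refine Finset.prod_congr rfl fun i _ => Finset.prod_congr rfl fun j _ => ?_
    refine congrArg (· ^ Q i j) (congrArg₂ _ ?_ ?_)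
    · exact prod2_perm (η1 j) (η2 i) (fun a b =>
        (X (⟨j, Fin.castAdd (v2 j) a⟩ : QVars I (v1 + v2)) -
          X (⟨i, Fin.natAdd (v1 i) b⟩ : QVars I (v1 + v2)) : QPoly k I (v1 + v2)))
    · exact prod2_perm (η1 i) (η2 j) (fun a b =>
        (C h + X (⟨i, Fin.castAdd (v2 i) a⟩ : QVars I (v1 + v2)) -
          X (⟨j, Fin.natAdd (v1 j) b⟩ : QVars I (v1 + v2)) : QPoly k I (v1 + v2)))
  · refine Finset.prod_congr rfl fun i _ => ?_
    refine congrArg₂ _ ?_ ?_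
    · exact Equiv.prod_comp (η2 i) (fun b => ∏ c : Fin (w1 i),
        (C (u1 i c) - X (⟨i, Fin.natAdd (v1 i) b⟩ : QVars I (v1 + v2)) : QPoly k I (v1 + v2)))
    · exact Equiv.prod_comp (η1 i) (fun a => ∏ c : Fin (w2 i),
        (C h + X (⟨i, Fin.castAdd (v2 i) a⟩ : QVars I (v1 + v2)) - C (u2 i c) :
          QPoly k I (v1 + v2)))

lemma gNegKernel_symm (v1 v2 : I → ℕ)
    (η1 : ∀ i : I, Equiv.Perm (Fin (v1 i))) (η2 : ∀ i : I, Equiv.Perm (Fin (v2 i))) :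
    rename (⇑(Equiv.sigmaCongrRight (blkV η1 η2))) (gNegKernel (k := k) v1 v2) =
      gNegKernel v1 v2 := by
  unfold gNegKernel
  simp only [map_prod, map_sub, rename_X, blkV_cast, blkV_nat]
  refine Finset.prod_congr rfl fun i _ => ?_
  exact prod2_perm (η1 i) (η2 i) (fun a b =>
        (X (⟨i, Fin.castAdd (v2 i) a⟩ : QVars I (v1 + v2)) -
          X (⟨i, Fin.natAdd (v1 i) b⟩ : QVars I (v1 + v2)) : QPoly k I (v1 + v2)))

lemma rename_blkV_emb1 {v1 v2 : I → ℕ} (η1 : ∀ i : I, Equiv.Perm (Fin (v1 i)))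
    (η2 : ∀ i : I, Equiv.Perm (Fin (v2 i))) (f : QPoly k I v1) :
    rename (⇑(Equiv.sigmaCongrRight (blkV η1 η2))) (rename (emb1 v1 v2) f) =
      rename (emb1 v1 v2) (rename (⇑(Equiv.sigmaCongrRight η1)) f) := by
  rw [rename_rename, rename_rename]
  congr 2
  funext x
  exact blkV_cast η1 η2 x.1 x.2

lemma rename_blkV_emb2 {v1 v2 : I → ℕ} (η1 : ∀ i : I, Equiv.Perm (Fin (v1 i)))
    (η2 : ∀ i : I, Equiv.Perm (Fin (v2 i))) (f : QPoly k I v2) :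
    rename (⇑(Equiv.sigmaCongrRight (blkV η1 η2))) (rename (emb2 v1 v2) f) =
      rename (emb2 v1 v2) (rename (⇑(Equiv.sigmaCongrRight η2)) f) := by
  rw [rename_rename, rename_rename]
  congr 2
  funext x
  exact blkV_nat η1 η2 x.1 x.2

/-- The term to be shuffled. -/
noncomputable def bTerm (Q : I → I → ℕ) (h : k) (v1 v2 w1 w2 : I → ℕ)
    (u1 : ∀ i, Fin (w1 i) → k) (u2 : ∀ i, Fin (w2 i) → k)
    (f1 : QPoly k I v1) (f2 : QPoly k I v2) : QFrac k I (v1 + v2) :=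
  algebraMap (QPoly k I (v1 + v2)) (QFrac k I (v1 + v2))
            (eulerKernel Q h v1 v2 w1 w2 u1 u2 *
              rename (emb1 v1 v2) f1 * rename (emb2 v1 v2) f2) /
          algebraMap (QPoly k I (v1 + v2)) (QFrac k I (v1 + v2)) (gNegKernel v1 v2)

lemma cohaMul_eq (Q : I → I → ℕ) (h : k) (v1 v2 w1 w2 : I → ℕ)
    (u1 : ∀ i, Fin (w1 i) → k) (u2 : ∀ i, Fin (w2 i) → k)
    (f1 : QPoly k I v1) (f2 : QPoly k I v2) :
    cohaMul Q h v1 v2 w1 w2 u1 u2 f1 f2 =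
      ∑ τ ∈ shs v1 v2, act (v := v1 + v2) τ (bTerm Q h v1 v2 w1 w2 u1 u2 f1 f2) := by
  unfold cohaMul shs
  rw [Finset.sum_filter]
  rfl

lemma bTerm_symm (Q : I → I → ℕ) (h : k) (v1 v2 w1 w2 : I → ℕ)
    (u1 : ∀ i, Fin (w1 i) → k) (u2 : ∀ i, Fin (w2 i) → k)
    (f1 : QPoly k I v1) (f2 : QPoly k I v2) (η1 : ∀ i : I, Equiv.Perm (Fin (v1 i)))
    (η2 : ∀ i : I, Equiv.Perm (Fin (v2 i))) :
    act (blkV η1 η2) (bTerm Q h v1 v2 w1 w2 u1 u2 f1 f2) =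
      bTerm Q h v1 v2 w1 w2 u1 u2 (rename (⇑(Equiv.sigmaCongrRight η1)) f1)
        (rename (⇑(Equiv.sigmaCongrRight η2)) f2) := by
  unfold bTerm
  rw [act_div, gNegKernel_symm, map_mul (rename _), map_mul (rename _), eulerKernel_symm, rename_blkV_emb1,
    rename_blkV_emb2]

/-- The canonical identification of variables. -/
def ascV (I : Type*) (v1 v2 v3 : I → ℕ) : QVars I (v1 + v2 + v3) ≃ QVars I (v1 + (v2 + v3)) :=
  Equiv.sigmaCongrRight (fun i : I => finCongr (Nat.add_assoc (v1 i) (v2 i) (v3 i)))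

lemma ascV_1 (v1 v2 v3 : I → ℕ) (i : I) (a : Fin (v1 i)) :
    ascV I v1 v2 v3 ⟨i, Fin.castAdd (v3 i) (Fin.castAdd (v2 i) a)⟩ =
      ⟨i, Fin.castAdd ((v2 + v3) i) a⟩ := rfl

lemma ascV_2 (v1 v2 v3 : I → ℕ) (i : I) (a : Fin (v2 i)) :
    ascV I v1 v2 v3 ⟨i, Fin.castAdd (v3 i) (Fin.natAdd (v1 i) a)⟩ =
      ⟨i, Fin.natAdd (v1 i) (Fin.castAdd (v3 i) a)⟩ := rfl

lemma ascV_3 (v1 v2 v3 : I → ℕ) (i : I) (a : Fin (v3 i)) :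
    ascV I v1 v2 v3 ⟨i, Fin.natAdd ((v1 + v2) i) a⟩ =
      ⟨i, Fin.natAdd (v1 i) (Fin.natAdd (v2 i) a)⟩ :=
  congrArg (Sigma.mk (β := fun i => Fin ((v1 + (v2 + v3)) i)) i) (fc3 a)

lemma prod_split {M : Type*} [CommMonoid M] (v1 v2 : I → ℕ) (i : I) (f : Fin ((v1 + v2) i) → M) :
    ∏ a, f a = (∏ a : Fin (v1 i), f (Fin.castAdd (v2 i) a)) *
      ∏ a : Fin (v2 i), f (Fin.natAdd (v1 i) a) :=
  Fin.prod_univ_add (a := v1 i) (b := v2 i) f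

/-- The kernel `e(g_v[-1])` in an arbitrary ring. -/
def gK {R : Type*} [CommRing R] {v1 v2 : I → ℕ} (x : ∀ i, Fin (v1 i) → R)
    (y : ∀ i, Fin (v2 i) → R) : R :=
  ∏ i : I, ∏ a : Fin (v1 i), ∏ b : Fin (v2 i), (x i a - y i b)

/-- The kernel `e(T*Rep(v,w)[-1])` in an arbitrary ring. -/
def eK {R : Type*} [CommRing R] (Q : I → I → ℕ) (h : R) {v1 v2 w1 w2 : I → ℕ}
    (x : ∀ i, Fin (v1 i) → R) (y : ∀ i, Fin (v2 i) → R) (u1 : ∀ i, Fin (w1 i) → R)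
    (u2 : ∀ i, Fin (w2 i) → R) : R :=
  (∏ i : I, ∏ j : I,
    ((∏ a : Fin (v1 j), ∏ b : Fin (v2 i), (x j a - y i b)) *
      ∏ a : Fin (v1 i), ∏ b : Fin (v2 j), (h + x i a - y j b)) ^ Q i j) *
  ∏ i : I,
    ((∏ b : Fin (v2 i), ∏ c : Fin (w1 i), (u1 i c - y i b)) *
      ∏ a : Fin (v1 i), ∏ c : Fin (w2 i), (h + x i a - u2 i c))

lemma gK_cocycle {R : Type*} [CommRing R] {v1 v2 v3 : I → ℕ}
    (x : ∀ i, Fin (v1 i) → R) (y : ∀ i, Fin (v2 i) → R) (z : ∀ i, Fin (v3 i) → R)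
    (x' : ∀ i, Fin (v1 i) → R) (y' : ∀ i, Fin (v2 i) → R) (z' : ∀ i, Fin (v3 i) → R)
    (xy : ∀ i, Fin ((v1 + v2) i) → R) (yz : ∀ i, Fin ((v2 + v3) i) → R)
    (e1 : ∀ i a, x' i a = x i a) (e2 : ∀ i a, y' i a = y i a) (e3 : ∀ i a, z' i a = z i a)
    (h1 : ∀ i a, xy i (Fin.castAdd (v2 i) a) = x i a)
    (h2 : ∀ i a, xy i (Fin.natAdd (v1 i) a) = y i a)
    (h3 : ∀ i a, yz i (Fin.castAdd (v3 i) a) = y i a)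
    (h4 : ∀ i a, yz i (Fin.natAdd (v2 i) a) = z i a) :
    gK xy z * gK x y = gK x' yz * gK y' z' := by
  unfold gK
  simp only [prod_split, e1, e2, e3, h1, h2, h3, h4, Finset.prod_mul_distrib]
  ring

lemma eK_cocycle {R : Type*} [CommRing R] (Q : I → I → ℕ) (h : R) {v1 v2 v3 w1 w2 w3 : I → ℕ}
    (x : ∀ i, Fin (v1 i) → R) (y : ∀ i, Fin (v2 i) → R) (z : ∀ i, Fin (v3 i) → R)
    (x' : ∀ i, Fin (v1 i) → R) (y' : ∀ i, Fin (v2 i) → R) (z' : ∀ i, Fin (v3 i) → R)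
    (xy : ∀ i, Fin ((v1 + v2) i) → R) (yz : ∀ i, Fin ((v2 + v3) i) → R)
    (e1 : ∀ i a, x' i a = x i a) (e2 : ∀ i a, y' i a = y i a) (e3 : ∀ i a, z' i a = z i a)
    (h1 : ∀ i a, xy i (Fin.castAdd (v2 i) a) = x i a)
    (h2 : ∀ i a, xy i (Fin.natAdd (v1 i) a) = y i a)
    (h3 : ∀ i a, yz i (Fin.castAdd (v3 i) a) = y i a)
    (h4 : ∀ i a, yz i (Fin.natAdd (v2 i) a) = z i a)
    (u1 : ∀ i, Fin (w1 i) → R) (u2 : ∀ i, Fin (w2 i) → R) (u3 : ∀ i, Fin (w3 i) → R)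
    (u12 : ∀ i, Fin ((w1 + w2) i) → R) (u23 : ∀ i, Fin ((w2 + w3) i) → R)
    (k1 : ∀ i a, u12 i (Fin.castAdd (w2 i) a) = u1 i a)
    (k2 : ∀ i a, u12 i (Fin.natAdd (w1 i) a) = u2 i a)
    (k3 : ∀ i a, u23 i (Fin.castAdd (w3 i) a) = u2 i a)
    (k4 : ∀ i a, u23 i (Fin.natAdd (w2 i) a) = u3 i a) :
    eK Q h xy z u12 u3 * eK Q h x y u1 u2 = eK Q h x' yz u1 u23 * eK Q h y' z' u2 u3 := by
  unfold eK
  simp only [prod_split, e1, e2, e3, h1, h2, h3, h4, k1, k2, k3, k4, Finset.prod_mul_distrib, mul_pow]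
  ac_rfl

lemma rename_gNeg {σ : Type*} {v1 v2 : I → ℕ} (e : QVars I (v1 + v2) → σ) :
    rename e (gNegKernel (k := k) v1 v2) =
      gK (fun i a => X (e ⟨i, Fin.castAdd (v2 i) a⟩)) (fun i a => X (e ⟨i, Fin.natAdd (v1 i) a⟩)) := by
  unfold gNegKernel gK
  simp only [map_prod, map_sub, rename_X]

lemma rename_euler {σ : Type*} (Q : I → I → ℕ) (h : k) {v1 v2 w1 w2 : I → ℕ}
    (u1 : ∀ i, Fin (w1 i) → k) (u2 : ∀ i, Fin (w2 i) → k) (e : QVars I (v1 + v2) → σ) :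
    rename e (eulerKernel Q h v1 v2 w1 w2 u1 u2) =
      eK Q (C h) (fun i a => X (e ⟨i, Fin.castAdd (v2 i) a⟩))
        (fun i a => X (e ⟨i, Fin.natAdd (v1 i) a⟩)) (fun i c => C (u1 i c))
        (fun i c => C (u2 i c)) := by
  unfold eulerKernel eK
  simp only [map_prod, map_mul, map_pow, map_add, map_sub, rename_X, rename_C]

lemma gNeg_cocycle (v1 v2 v3 : I → ℕ) :
    rename (ascV I v1 v2 v3) (gNegKernel (k := k) (v1 + v2) v3) *
      rename (ascV I v1 v2 v3) (rename (emb1 (v1 + v2) v3) (gNegKernel v1 v2)) =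
    gNegKernel v1 (v2 + v3) * rename (emb2 v1 (v2 + v3)) (gNegKernel v2 v3) := by
  rw [rename_rename, rename_gNeg, rename_gNeg, rename_gNeg,
    ← rename_id_apply (gNegKernel v1 (v2 + v3)), rename_gNeg]
  exact gK_cocycle _ _ _ _ _ _ _ _
    (fun i a => congrArg X (ascV_1 v1 v2 v3 i a).symm)
    (fun i a => congrArg X (ascV_2 v1 v2 v3 i a).symm)
    (fun i a => congrArg X (ascV_3 v1 v2 v3 i a).symm)
    (fun i a => rfl) (fun i a => rfl)
    (fun i a => congrArg X (ascV_2 v1 v2 v3 i a).symm)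
    (fun i a => congrArg X (ascV_3 v1 v2 v3 i a).symm)

lemma euler_cocycle (Q : I → I → ℕ) (h : k) (v1 v2 v3 w1 w2 w3 : I → ℕ)
    (u1 : ∀ i, Fin (w1 i) → k) (u2 : ∀ i, Fin (w2 i) → k) (u3 : ∀ i, Fin (w3 i) → k) :
    rename (ascV I v1 v2 v3) (eulerKernel Q h (v1 + v2) v3 (w1 + w2) w3
        (fun i => Fin.append (u1 i) (u2 i)) u3) *
      rename (ascV I v1 v2 v3)
        (rename (emb1 (v1 + v2) v3) (eulerKernel Q h v1 v2 w1 w2 u1 u2)) =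
    eulerKernel Q h v1 (v2 + v3) w1 (w2 + w3) u1 (fun i => Fin.append (u2 i) (u3 i)) *
      rename (emb2 v1 (v2 + v3)) (eulerKernel Q h v2 v3 w2 w3 u2 u3) := by
  rw [rename_rename, rename_euler, rename_euler, rename_euler,
    ← rename_id_apply (eulerKernel Q h v1 (v2 + v3) w1 (w2 + w3) u1 _), rename_euler]
  exact eK_cocycle Q _ _ _ _ _ _ _ _ _
    (fun i a => congrArg X (ascV_1 v1 v2 v3 i a).symm)
    (fun i a => congrArg X (ascV_2 v1 v2 v3 i a).symm)
    (fun i a => congrArg X (ascV_3 v1 v2 v3 i a).symm)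
    (fun i a => rfl) (fun i a => rfl)
    (fun i a => congrArg X (ascV_2 v1 v2 v3 i a).symm)
    (fun i a => congrArg X (ascV_3 v1 v2 v3 i a).symm) _ _ _ _ _
    (fun i a => congrArg C (Fin.append_left (u1 i) (u2 i) a))
    (fun i a => congrArg C (Fin.append_right (u1 i) (u2 i) a))
    (fun i a => congrArg C (Fin.append_left (u2 i) (u3 i) a))
    (fun i a => congrArg C (Fin.append_right (u2 i) (u3 i) a))

/-! ### Associativity -/

lemma bTerm_right (Q : I → I → ℕ) (h : k) (v1 v2 w1 w2 : I → ℕ)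
    (u1 : ∀ i, Fin (w1 i) → k) (u2 : ∀ i, Fin (w2 i) → k)
    (f1 : QPoly k I v1) (f2 : QPoly k I v2) :
    bTerm Q h v1 v2 w1 w2 u1 u2 f1 f2 = bTerm Q h v1 v2 w1 w2 u1 u2 f1 1 *
      qFracMap (emb2 v1 v2) (emb2_injective v1 v2)
        (algebraMap (QPoly k I v2) (QFrac k I v2) f2) := by
  unfold bTerm
  rw [qFracMap_algebraMap, map_one, mul_one, map_mul (algebraMap _ _)]
  ring

lemma bTerm_left (Q : I → I → ℕ) (h : k) (v1 v2 w1 w2 : I → ℕ)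
    (u1 : ∀ i, Fin (w1 i) → k) (u2 : ∀ i, Fin (w2 i) → k)
    (f1 : QPoly k I v1) (f2 : QPoly k I v2) :
    bTerm Q h v1 v2 w1 w2 u1 u2 f1 f2 = bTerm Q h v1 v2 w1 w2 u1 u2 1 f2 *
      qFracMap (emb1 v1 v2) (emb1_injective v1 v2)
        (algebraMap (QPoly k I v1) (QFrac k I v1) f1) := by
  unfold bTerm
  rw [qFracMap_algebraMap, map_one, mul_one, mul_right_comm, map_mul (algebraMap _ _)]
  ring

lemma rename_sigma_one {v : I → ℕ} (f : QPoly k I v) :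
    rename (⇑(Equiv.sigmaCongrRight (fun i => (1 : Equiv.Perm (Fin (v i)))))) f = f := by
  conv_rhs => rw [← rename_id_apply f]
  rfl

lemma qFracMap_comm {v v' u' v'' : I → ℕ} (e : QVars I v → QVars I v')
    (he : Function.Injective e) (e' : QVars I v' → QVars I v'')
    (he' : Function.Injective e') (d : QVars I v → QVars I u')
    (hd : Function.Injective d) (d' : QVars I u' → QVars I v'')
    (hd' : Function.Injective d') (hc : ∀ x, e' (e x) = d' (d x)) (z : QFrac k I v) :
    qFracMap e' he' (qFracMap e he z) = qFracMap d' hd' (qFracMap d hd z) := by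
  rw [qFracMap_comp e he e' he' _ (he'.comp he) (fun _ => rfl),
    qFracMap_comp d hd d' hd' _ (he'.comp he) (fun x => (hc x).symm)]

lemma emb2_act {v1 v2 : I → ℕ} (τ : ∀ i, Equiv.Perm (Fin (v2 i))) (z : QFrac k I v2) :
    qFracMap (emb2 v1 v2) (emb2_injective v1 v2) (act τ z) =
      act (blkV (fun _ => 1) τ) (qFracMap (emb2 v1 v2) (emb2_injective v1 v2) z) := by
  unfold act
  apply qFracMap_comm
  intro x
  exact (blkV_nat _ τ x.1 x.2).symm

lemma emb1_act {v1 v2 : I → ℕ} (τ : ∀ i, Equiv.Perm (Fin (v1 i))) (z : QFrac k I v1) :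
    qFracMap (emb1 v1 v2) (emb1_injective v1 v2) (act τ z) =
      act (blkV τ (fun _ => 1)) (qFracMap (emb1 v1 v2) (emb1_injective v1 v2) z) := by
  unfold act
  apply qFracMap_comm
  intro x
  exact (blkV_cast τ _ x.1 x.2).symm

lemma cohaMul_right (Q : I → I → ℕ) (h : k) (v1 v2 w1 w2 : I → ℕ)
    (u1 : ∀ i, Fin (w1 i) → k) (u2 : ∀ i, Fin (w2 i) → k)
    (f1 : QPoly k I v1) (f2 : QPoly k I v2)
    (s : Finset (∀ i, Equiv.Perm (Fin (v2 i)))) (B : QFrac k I v2)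
    (hf : algebraMap (QPoly k I v2) (QFrac k I v2) f2 = ∑ τ ∈ s, act τ B) :
    cohaMul Q h v1 v2 w1 w2 u1 u2 f1 f2 =
      ∑ σ ∈ shs v1 v2, ∑ τ ∈ s, act (v := v1 + v2) (fun i => σ i * blk 1 (τ i))
        (bTerm Q h v1 v2 w1 w2 u1 u2 f1 1 * qFracMap (emb2 v1 v2) (emb2_injective v1 v2) B) := by
  rw [cohaMul_eq]
  refine Finset.sum_congr rfl fun σ _ => ?_
  rw [bTerm_right, hf, map_sum, Finset.mul_sum, map_sum]
  refine Finset.sum_congr rfl fun τ _ => ?_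
  rw [emb2_act]
  have : bTerm Q h v1 v2 w1 w2 u1 u2 f1 1 =
      act (blkV (fun _ => 1) τ) (bTerm Q h v1 v2 w1 w2 u1 u2 f1 1) := by
    rw [bTerm_symm, rename_sigma_one, map_one]
  conv_lhs => rw [this]
  rw [← map_mul, act_act]
  rfl

lemma cohaMul_left (Q : I → I → ℕ) (h : k) (v1 v2 w1 w2 : I → ℕ)
    (u1 : ∀ i, Fin (w1 i) → k) (u2 : ∀ i, Fin (w2 i) → k)
    (f1 : QPoly k I v1) (f2 : QPoly k I v2)
    (s : Finset (∀ i, Equiv.Perm (Fin (v1 i)))) (B : QFrac k I v1)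
    (hf : algebraMap (QPoly k I v1) (QFrac k I v1) f1 = ∑ τ ∈ s, act τ B) :
    cohaMul Q h v1 v2 w1 w2 u1 u2 f1 f2 =
      ∑ σ ∈ shs v1 v2, ∑ τ ∈ s, act (v := v1 + v2) (fun i => σ i * blk (τ i) 1)
        (bTerm Q h v1 v2 w1 w2 u1 u2 1 f2 * qFracMap (emb1 v1 v2) (emb1_injective v1 v2) B) := by
  rw [cohaMul_eq]
  refine Finset.sum_congr rfl fun σ _ => ?_
  rw [bTerm_left, hf, map_sum, Finset.mul_sum, map_sum]
  refine Finset.sum_congr rfl fun τ _ => ?_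
  rw [emb1_act]
  have : bTerm Q h v1 v2 w1 w2 u1 u2 1 f2 =
      act (blkV τ (fun _ => 1)) (bTerm Q h v1 v2 w1 w2 u1 u2 1 f2) := by
    rw [bTerm_symm, rename_sigma_one, map_one]
  conv_lhs => rw [this]
  rw [← map_mul, act_act]
  rfl

lemma asc_act {v1 v2 v3 : I → ℕ} (ρ : ∀ i, Equiv.Perm (Fin (v1 i + v2 i + v3 i)))
    (z : QFrac k I (v1 + v2 + v3)) :
    qFracMap (ascV I v1 v2 v3) (ascV I v1 v2 v3).injective (act (v := v1 + v2 + v3) ρ z) =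
      act (v := v1 + (v2 + v3)) (fun i => asc (ρ i))
        (qFracMap (ascV I v1 v2 v3) (ascV I v1 v2 v3).injective z) := by
  unfold act
  apply qFracMap_comm
  rintro ⟨i, a⟩
  rfl

lemma asc_term (Q : I → I → ℕ) (h : k) (v1 v2 v3 w1 w2 w3 : I → ℕ)
    (u1 : ∀ i, Fin (w1 i) → k) (u2 : ∀ i, Fin (w2 i) → k) (u3 : ∀ i, Fin (w3 i) → k)
    (f1 : QPoly k I v1) (f2 : QPoly k I v2) (f3 : QPoly k I v3) :
    qFracMap (ascV I v1 v2 v3) (ascV I v1 v2 v3).injective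
      (bTerm Q h (v1 + v2) v3 (w1 + w2) w3 (fun i => Fin.append (u1 i) (u2 i)) u3 1 f3 *
        qFracMap (emb1 (v1 + v2) v3) (emb1_injective (v1 + v2) v3)
          (bTerm Q h v1 v2 w1 w2 u1 u2 f1 f2)) =
      bTerm Q h v1 (v2 + v3) w1 (w2 + w3) u1 (fun i => Fin.append (u2 i) (u3 i)) f1 1 *
        qFracMap (emb2 v1 (v2 + v3)) (emb2_injective v1 (v2 + v3))
          (bTerm Q h v2 v3 w2 w3 u2 u3 f2 f3) := by
  unfold bTerm
  rw [map_mul (qFracMap _ _), qFracMap_div, qFracMap_div, qFracMap_div, qFracMap_div,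
    div_mul_div_comm, div_mul_div_comm, ← map_mul (algebraMap _ _), ← map_mul (algebraMap _ _),
    ← map_mul (algebraMap _ _), ← map_mul (algebraMap _ _), gNeg_cocycle]
  congr 2
  simp only [map_mul, map_one, mul_one]
  have e1 : rename (ascV I v1 v2 v3) (rename (emb2 (v1 + v2) v3) f3) =
      rename (emb2 v1 (v2 + v3)) (rename (emb2 v2 v3) f3) := by
    rw [rename_rename, rename_rename]
    congr 2
    funext x
    exact ascV_3 v1 v2 v3 x.1 x.2
  have e2 : rename (ascV I v1 v2 v3) (rename (emb1 (v1 + v2) v3) (rename (emb2 v1 v2) f2)) =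
      rename (emb2 v1 (v2 + v3)) (rename (emb1 v2 v3) f2) := by
    rw [rename_rename, rename_rename, rename_rename]
    rfl
  have e3 : rename (ascV I v1 v2 v3) (rename (emb1 (v1 + v2) v3) (rename (emb1 v1 v2) f1)) =
      rename (emb1 v1 (v2 + v3)) f1 := by
    rw [rename_rename, rename_rename]
    rfl
  rw [e1, e2, e3]
  have := euler_cocycle Q h v1 v2 v3 w1 w2 w3 u1 u2 u3
  linear_combination (rename (emb2 v1 (v2 + v3)) (rename (emb2 v2 v3) f3)) *
    (rename (emb2 v1 (v2 + v3)) (rename (emb1 v2 v3) f2)) *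
    (rename (emb1 v1 (v2 + v3)) f1) * this

lemma coha_assoc (Q : I → I → ℕ) (h : k) (v1 v2 w1 w2 : I → ℕ)
    (u1 : ∀ i, Fin (w1 i) → k) (u2 : ∀ i, Fin (w2 i) → k)
    (f1 : QPoly k I v1) (f2 : QPoly k I v2) (v3 w3 : I → ℕ) (u3 : ∀ i, Fin (w3 i) → k)
      (f3 : QPoly k I v3) (g12 : QPoly k I (v1 + v2)) (g23 : QPoly k I (v2 + v3))
      (h12 : algebraMap (QPoly k I (v1 + v2)) (QFrac k I (v1 + v2)) g12 =
        cohaMul Q h v1 v2 w1 w2 u1 u2 f1 f2)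
      (h23 : algebraMap (QPoly k I (v2 + v3)) (QFrac k I (v2 + v3)) g23 =
        cohaMul Q h v2 v3 w2 w3 u2 u3 f2 f3) :
      qFracMap (ascV I v1 v2 v3) (ascV I v1 v2 v3).injective
          (cohaMul Q h (v1 + v2) v3 (w1 + w2) w3
            (fun i => Fin.append (u1 i) (u2 i)) u3 g12 f3) =
        cohaMul Q h v1 (v2 + v3) w1 (w2 + w3)
          u1 (fun i => Fin.append (u2 i) (u3 i)) f1 g23 := by
  rw [cohaMul_eq] at h12 h23
  rw [cohaMul_right _ _ _ _ _ _ _ _ _ _ _ _ h23, cohaMul_left _ _ _ _ _ _ _ _ _ _ _ _ h12]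
  refine Eq.trans ?_ (sum_right v1 v2 v3 (fun ρ => act (v := v1 + (v2 + v3)) ρ _)).symm
  rw [← sum_left, map_sum]
  refine Finset.sum_congr rfl fun σ _ => ?_
  rw [map_sum]
  refine Finset.sum_congr rfl fun τ _ => ?_
  rw [← asc_term]
  exact asc_act _ _

/-! ### Integrality at a prime -/

/-- Fractions which can be written without `p` in the denominator. -/
def InO {R : Type*} [CommRing R] [IsDomain R] (p : R) (z : FractionRing R) : Prop :=
  ∃ E, ¬ p ∣ E ∧ ∃ N, z * algebraMap R (FractionRing R) E = algebraMap R (FractionRing R) N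

/-- The additive subgroup of `p`-integral fractions. -/
def locInt {R : Type*} [CommRing R] [IsDomain R] (p : R) (hp : Prime p) :
    AddSubgroup (FractionRing R) where
  carrier := {z | InO p z}
  zero_mem' := ⟨1, hp.not_dvd_one, 0, by simp⟩
  add_mem' := by
    rintro x y ⟨E, hE, N, h⟩ ⟨E2, hE2, N2, h2⟩
    refine ⟨E * E2, fun hd => (hp.dvd_or_dvd hd).elim hE hE2, N * E2 + N2 * E, ?_⟩
    simp only [map_mul, map_add, ← h, ← h2]
    ring
  neg_mem' := by
    rintro x ⟨E, hE, N, h⟩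
    exact ⟨E, hE, -N, by rw [map_neg, ← h]; ring⟩

lemma InO.mul {R : Type*} [CommRing R] [IsDomain R] {p : R} {z : FractionRing R} (h : InO p z)
    (r : R) : InO p (z * algebraMap R (FractionRing R) r) := by
  obtain ⟨E, hE, N, h⟩ := h
  refine ⟨E, hE, N * r, ?_⟩
  rw [map_mul, ← h]
  ring

/-- `D` can be cleared from denominators of fractions integral at all primes of `S`. -/
def Clears {R : Type*} [CommRing R] [IsDomain R] (S : Set R) (D : R) : Prop :=
  ∀ z : FractionRing R, (∀ p ∈ S, InO p z) →
    (∃ N, z * algebraMap R (FractionRing R) D = algebraMap R (FractionRing R) N) →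
    ∃ N, z = algebraMap R (FractionRing R) N

lemma Clears.one {R : Type*} [CommRing R] [IsDomain R] (S : Set R) : Clears S 1 := by
  rintro z - ⟨N, h⟩
  exact ⟨N, by simpa using h⟩

lemma Clears.mul {R : Type*} [CommRing R] [IsDomain R] {S : Set R} {D E : R} (hD : Clears S D)
    (hE : Clears S E) : Clears S (D * E) := by
  rintro z hz ⟨N, h⟩
  refine hD z hz (hE _ (fun p hp => (hz p hp).mul D) ⟨N, ?_⟩)
  rw [← h, map_mul]
  ring

lemma Clears.prime {R : Type*} [CommRing R] [IsDomain R] {S : Set R} {p : R} (hp : Prime p)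
    (hS : p ∈ S) : Clears S p := by
  rintro z hz ⟨N, h⟩
  obtain ⟨E, hE, M, h2⟩ := hz p hS
  have : N * E = M * p := by
    apply IsFractionRing.injective R (FractionRing R)
    rw [map_mul, map_mul, ← h, ← h2]
    ring
  obtain ⟨N2, rfl⟩ := (hp.dvd_or_dvd (this ▸ dvd_mul_left p M : p ∣ N * E)).resolve_right hE
  refine ⟨N2, ?_⟩
  have h0 : algebraMap R (FractionRing R) p ≠ 0 := by
    simpa using hp.ne_zero
  apply mul_right_cancel₀ h0
  rw [h, map_mul]
  ring

/-! ### The primes `X a - X b` -/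

lemma sub_dvd_iff {ι : Type*} [DecidableEq ι] (a b : ι) (P : MvPolynomial ι k) :
    (X a - X b : MvPolynomial ι k) ∣ P ↔ rename (fun c => if c = a then b else c) P = 0 := by
  constructor
  · rintro ⟨Q, rfl⟩
    rw [map_mul, map_sub, rename_X, rename_X]
    by_cases h : b = a <;> simp [h]
  · intro h
    rw [← Ideal.Quotient.eq_zero_iff_dvd]
    have key : ((Ideal.Quotient.mk (Ideal.span {(X a - X b : MvPolynomial ι k)})).comp
        (rename (fun c => if c = a then b else c) :
          MvPolynomial ι k →ₐ[k] MvPolynomial ι k).toRingHom) =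
        Ideal.Quotient.mk (Ideal.span {(X a - X b : MvPolynomial ι k)}) := by
      apply MvPolynomial.ringHom_ext
      · intro r
        simp
      · intro c
        by_cases hc : c = a
        · subst hc
          simp only [RingHom.comp_apply, AlgHom.toRingHom_eq_coe, RingHom.coe_coe, rename_X, if_true]
          symm
          rw [Ideal.Quotient.eq]
          exact Ideal.mem_span_singleton_self _
        · simp [hc]
    have := congrArg (fun f => f P) key
    simp only [RingHom.comp_apply, AlgHom.toRingHom_eq_coe, RingHom.coe_coe, h, map_zero] at this
    exact this.symm

lemma prime_sub {ι : Type*} [DecidableEq ι] {a b : ι} (h : a ≠ b) : Prime (X a - X b : MvPolynomial ι k) := by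
  refine ⟨sub_ne_zero.2 fun e => h (X_injective e), ?_, ?_⟩
  · intro hu
    have := (sub_dvd_iff a b (1 : MvPolynomial ι k)).1 hu.dvd
    simp at this
  · intro P Q hd
    rw [sub_dvd_iff, map_mul, mul_eq_zero] at hd
    simpa only [sub_dvd_iff] using hd

lemma sub_dvd_sub {ι : Type*} [DecidableEq ι] {a b c d : ι} (h : c ≠ d)
    (hd : (X a - X b : MvPolynomial ι k) ∣ X c - X d) : (c = a ∧ d = b) ∨ (c = b ∧ d = a) := by
  rw [sub_dvd_iff, map_sub, rename_X, rename_X, sub_eq_zero] at hd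
  have := X_injective hd
  split_ifs at this with h1 h2 h2
  · exact absurd (h1.trans h2.symm) h
  · exact Or.inl ⟨h1, this.symm⟩
  · exact Or.inr ⟨this, h2⟩
  · exact absurd this h

lemma sub_dvd_swap {ι : Type*} [DecidableEq ι] (a b : ι) (P : MvPolynomial ι k) :
    (X a - X b : MvPolynomial ι k) ∣ P - rename (Equiv.swap a b) P := by
  rw [sub_dvd_iff, map_sub, rename_rename, sub_eq_zero]
  congr 2
  funext c
  simp only [Function.comp, Equiv.swap_apply_def]
  split_ifs <;> simp_all

lemma rename_swap_swap {ι : Type*} [DecidableEq ι] (a b : ι) (P : MvPolynomial ι k) :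
    rename (Equiv.swap a b) (rename (Equiv.swap a b) P) = P := by
  rw [rename_rename]
  conv_rhs => rw [← rename_id_apply P]
  congr 2
  funext c
  simp

lemma sub_dvd_rename_swap {ι : Type*} [DecidableEq ι] {a b : ι} {P : MvPolynomial ι k}
    (h : (X a - X b : MvPolynomial ι k) ∣ rename (Equiv.swap a b) P) :
    (X a - X b : MvPolynomial ι k) ∣ P := by
  have := dvd_add (sub_dvd_swap a b P) h
  simpa using this

lemma gNeg_dvd {ι : Type*} [DecidableEq ι] {v1 v2 : I → ℕ} (e : QVars I (v1 + v2) ≃ ι) {x y : ι}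
    (hxy : x ≠ y)
    (hd : (X x - X y : MvPolynomial ι k) ∣ rename e (gNegKernel (k := k) v1 v2)) :
    ∃ (g : MvPolynomial ι k) (j : I) (l : Fin (v1 j)) (r : Fin (v2 j)),
      rename e (gNegKernel (k := k) v1 v2) = (X (e ⟨j, Fin.castAdd (v2 j) l⟩) -
        X (e ⟨j, Fin.natAdd (v1 j) r⟩)) * g ∧ ¬ (X x - X y : MvPolynomial ι k) ∣ g ∧
      ((e ⟨j, Fin.castAdd (v2 j) l⟩ = x ∧ e ⟨j, Fin.natAdd (v1 j) r⟩ = y) ∨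
        (e ⟨j, Fin.castAdd (v2 j) l⟩ = y ∧ e ⟨j, Fin.natAdd (v1 j) r⟩ = x)) := by
  let F : (Σ i : I, Fin (v1 i) × Fin (v2 i)) → MvPolynomial ι k := fun q =>
    X (e ⟨q.1, Fin.castAdd (v2 q.1) q.2.1⟩) - X (e ⟨q.1, Fin.natAdd (v1 q.1) q.2.2⟩)
  have hp := prime_sub (k := k) hxy
  have hG : rename e (gNegKernel (k := k) v1 v2) = ∏ q, F q := by
    rw [rename_gNeg, gK, Fintype.prod_sigma]
    refine Finset.prod_congr rfl fun i _ => ?_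
    rw [Fintype.prod_prod_type]
  have hne : ∀ (j : I) (l : Fin (v1 j)) (r : Fin (v2 j)),
      (⟨j, Fin.castAdd (v2 j) l⟩ : QVars I (v1 + v2)) ≠ ⟨j, Fin.natAdd (v1 j) r⟩ := by
    intro j l r hh
    have := congrArg (fun s : QVars I (v1 + v2) => (s.2 : ℕ)) hh
    simp at this
    omega
  have hF : ∀ q, (X x - X y : MvPolynomial ι k) ∣ F q →
      ((e ⟨q.1, Fin.castAdd (v2 q.1) q.2.1⟩ = x ∧ e ⟨q.1, Fin.natAdd (v1 q.1) q.2.2⟩ = y) ∨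
        (e ⟨q.1, Fin.castAdd (v2 q.1) q.2.1⟩ = y ∧ e ⟨q.1, Fin.natAdd (v1 q.1) q.2.2⟩ = x)) := by
    intro q hq
    exact sub_dvd_sub (fun h => hne _ _ _ (e.injective h)) hq
  rw [hG] at hd ⊢
  obtain ⟨q, -, hq⟩ := hp.exists_mem_finset_dvd hd
  refine ⟨∏ q' ∈ Finset.univ.erase q, F q', q.1, q.2.1, q.2.2,
    (Finset.mul_prod_erase _ F (Finset.mem_univ q)).symm, ?_, hF q hq⟩
  intro hd2
  obtain ⟨q2, hm, hq2⟩ := hp.exists_mem_finset_dvd hd2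
  have hqq := (Finset.mem_erase.1 hm).1
  apply hqq
  obtain ⟨j, l, r⟩ := q
  obtain ⟨j2, l2, r2⟩ := q2
  have fin : ∀ {s s' : QVars I (v1 + v2)}, s = s' → s.1 = s'.1 ∧ (s.2 : ℕ) = (s'.2 : ℕ) := by
    rintro s s' rfl
    exact ⟨rfl, rfl⟩
  rcases hF _ hq with ⟨h1, h2⟩ | ⟨h1, h2⟩ <;> rcases hF _ hq2 with ⟨h3, h4⟩ | ⟨h3, h4⟩
  · have a1 := fin (e.injective (h1.trans h3.symm))
    have a2 := fin (e.injective (h2.trans h4.symm))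
    simp only at a1 a2
    obtain ⟨rfl, a1⟩ := a1
    simp only [Fin.val_castAdd, Fin.val_natAdd] at a1 a2
    have b1 : l = l2 := Fin.ext a1
    have b2 : r = r2 := Fin.ext (by omega)
    rw [b1, b2]
  · have a1 := fin (e.injective (h1.trans h4.symm))
    simp only at a1
    obtain ⟨rfl, a1⟩ := a1
    simp only [Fin.val_castAdd, Fin.val_natAdd] at a1
    have := l.2
    omega
  · have a1 := fin (e.injective (h1.trans h4.symm))
    simp only at a1
    obtain ⟨rfl, a1⟩ := a1
    simp only [Fin.val_castAdd, Fin.val_natAdd] at a1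
    have := l.2
    omega
  · have a1 := fin (e.injective (h1.trans h3.symm))
    have a2 := fin (e.injective (h2.trans h4.symm))
    simp only at a1 a2
    obtain ⟨rfl, a1⟩ := a1
    simp only [Fin.val_castAdd, Fin.val_natAdd] at a1 a2
    have b1 : l = l2 := Fin.ext a1
    have b2 : r = r2 := Fin.ext (by omega)
    rw [b1, b2]

/-! ### Reduction to shuffles -/

lemma exists_shuffleV {v1 v2 : I → ℕ} (ρ : ∀ i, Equiv.Perm (Fin (v1 i + v2 i))) :
    ∃ σ, σ ∈ shs v1 v2 ∧ ∃ (η1 : ∀ i, Equiv.Perm (Fin (v1 i))) (η2 : ∀ i, Equiv.Perm (Fin (v2 i))),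
      ρ = fun i => σ i * blk (η1 i) (η2 i) := by
  choose σ hσ η1 η2 h using fun i => exists_shuffle (ρ i)
  exact ⟨σ, mem_shs.2 hσ, η1, η2, funext h⟩

/-- The shuffle in the coset of `ρ`. -/
noncomputable def rd {v1 v2 : I → ℕ} (ρ : ∀ i, Equiv.Perm (Fin (v1 i + v2 i))) :
    ∀ i, Equiv.Perm (Fin (v1 i + v2 i)) := (exists_shuffleV ρ).choose

lemma rd_mem {v1 v2 : I → ℕ} (ρ : ∀ i, Equiv.Perm (Fin (v1 i + v2 i))) : rd ρ ∈ shs v1 v2 :=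
  (exists_shuffleV ρ).choose_spec.1

lemma rd_spec {v1 v2 : I → ℕ} (ρ : ∀ i, Equiv.Perm (Fin (v1 i + v2 i))) :
    ∃ (η1 : ∀ i, Equiv.Perm (Fin (v1 i))) (η2 : ∀ i, Equiv.Perm (Fin (v2 i))),
      ρ = fun i => rd ρ i * blk (η1 i) (η2 i) :=
  (exists_shuffleV ρ).choose_spec.2

lemma rd_eq {v1 v2 : I → ℕ} {σ : ∀ i, Equiv.Perm (Fin (v1 i + v2 i))} (hσ : σ ∈ shs v1 v2)
    (η1 : ∀ i, Equiv.Perm (Fin (v1 i))) (η2 : ∀ i, Equiv.Perm (Fin (v2 i))) :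
    rd (fun i => σ i * blk (η1 i) (η2 i)) = σ := by
  obtain ⟨μ1, μ2, h⟩ := rd_spec (fun i => σ i * blk (η1 i) (η2 i))
  funext i
  exact ((shuffle_unique (mem_shs.1 hσ i) (mem_shs.1 (rd_mem _) i) (congrFun h i)).1).symm

lemma rd_rd {v1 v2 : I → ℕ} {σ : ∀ i, Equiv.Perm (Fin (v1 i + v2 i))} (hσ : σ ∈ shs v1 v2)
    (t s : ∀ i, Equiv.Perm (Fin (v1 i + v2 i))) (hts : ∀ i, t i * s i = 1) :
    rd (fun i => t i * rd (fun i => s i * σ i) i) = σ := by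
  obtain ⟨η1, η2, h⟩ := rd_spec (fun i => s i * σ i)
  have : (fun i => t i * rd (fun i => s i * σ i) i) =
      fun i => σ i * blk ((η1 i)⁻¹) ((η2 i)⁻¹) := by
    funext i
    have hi := congrFun h i
    rw [← blk_inv, eq_mul_inv_iff_mul_eq, mul_assoc, ← hi, ← mul_assoc, hts, one_mul]
  rw [this]
  exact rd_eq hσ _ _

/-- Invariance under block permutations. -/
def BInv {v1 v2 : I → ℕ} (B : QFrac k I (v1 + v2)) : Prop :=
  ∀ (η1 : ∀ i, Equiv.Perm (Fin (v1 i))) (η2 : ∀ i, Equiv.Perm (Fin (v2 i))),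
    act (blkV η1 η2) B = B

lemma act_rd {v1 v2 : I → ℕ} {B : QFrac k I (v1 + v2)} (hB : BInv B)
    (ρ : ∀ i, Equiv.Perm (Fin (v1 i + v2 i))) :
    act (v := v1 + v2) (rd ρ) B = act (v := v1 + v2) ρ B := by
  obtain ⟨η1, η2, h⟩ := rd_spec ρ
  have h2 : act (v := v1 + v2) ρ B =
      act (v := v1 + v2) (fun i => rd ρ i * blk (η1 i) (η2 i)) B := congrArg (fun r => act (v := v1 + v2) r B) h
  rw [h2]
  conv_lhs => rw [← hB η1 η2, act_act]
  rfl

lemma shuffle_sum_symm {v1 v2 : I → ℕ} {B : QFrac k I (v1 + v2)} (hB : BInv B)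
    (t : ∀ i, Equiv.Perm (Fin (v1 i + v2 i))) :
    act (v := v1 + v2) t (∑ σ ∈ shs v1 v2, act (v := v1 + v2) σ B) =
      ∑ σ ∈ shs v1 v2, act (v := v1 + v2) σ B := by
  rw [map_sum]
  refine Finset.sum_bij' (fun σ _ => rd (fun i => t i * σ i))
    (fun σ _ => rd (fun i => (t i)⁻¹ * σ i)) (fun _ _ => rd_mem _) (fun _ _ => rd_mem _)
    ?_ ?_ ?_
  · intro σ hσ
    exact rd_rd hσ (fun i => (t i)⁻¹) t (fun i => inv_mul_cancel _)
  · intro σ hσ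
    exact rd_rd hσ t (fun i => (t i)⁻¹) (fun i => mul_inv_cancel _)
  · intro σ hσ
    rw [act_rd hB, act_act]

/-- The transposition of `a` and `b` at vertex `i`. -/
def tr {v1 v2 : I → ℕ} (i : I) (a b : Fin (v1 i + v2 i)) :
    ∀ i, Equiv.Perm (Fin (v1 i + v2 i)) :=
  Function.update (fun _ => 1) i (Equiv.swap a b)

lemma tr_tr {v1 v2 : I → ℕ} (i : I) (a b : Fin (v1 i + v2 i)) (j : I) :
    tr i a b j * tr i a b j = 1 := by
  unfold tr
  by_cases h : j = i
  · subst h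
    simp
  · simp [h]

lemma tr_swap {v1 v2 : I → ℕ} (i : I) (a b : Fin (v1 i + v2 i)) (x : QVars I (v1 + v2)) :
    Equiv.sigmaCongrRight (α := I) (β₁ := fun i => Fin ((v1 + v2) i))
      (β₂ := fun i => Fin ((v1 + v2) i)) (tr i a b) x =
      Equiv.swap (⟨i, a⟩ : QVars I (v1 + v2)) ⟨i, b⟩ x := by
  obtain ⟨j, c⟩ := x
  by_cases h : j = i
  · subst h
    simp only [tr, Equiv.sigmaCongrRight_apply, Sigma.map, Function.update_self,
      Equiv.swap_apply_def, Sigma.mk.injEq, heq_eq_eq, true_and, id]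
    split_ifs <;> rfl
  · have h1 : (⟨j, c⟩ : QVars I (v1 + v2)) ≠ ⟨i, a⟩ := fun e => h (congrArg Sigma.fst e)
    have h2 : (⟨j, c⟩ : QVars I (v1 + v2)) ≠ ⟨i, b⟩ := fun e => h (congrArg Sigma.fst e)
    rw [Equiv.swap_apply_of_ne_of_ne h1 h2]
    simp only [tr, Equiv.sigmaCongrRight_apply, Sigma.map, id, Function.update_of_ne h]
    rfl

/-- The relabelling of variables attached to a family of permutations. -/
def sE {v1 v2 : I → ℕ} (σ : ∀ i, Equiv.Perm (Fin (v1 i + v2 i))) :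
    QVars I (v1 + v2) ≃ QVars I (v1 + v2) :=
  Equiv.sigmaCongrRight (α := I) (β₁ := fun i => Fin ((v1 + v2) i))
      (β₂ := fun i => Fin ((v1 + v2) i)) σ

lemma sE_apply {v1 v2 : I → ℕ} (σ : ∀ i, Equiv.Perm (Fin (v1 i + v2 i))) (i : I)
    (c : Fin (v1 i + v2 i)) :
    sE σ (⟨i, c⟩ : QVars I (v1 + v2)) = (⟨i, σ i c⟩ : QVars I (v1 + v2)) := rfl

lemma act_frac {v1 v2 : I → ℕ} (σ : ∀ i, Equiv.Perm (Fin (v1 i + v2 i)))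
    (A G : QPoly k I (v1 + v2)) :
    act (v := v1 + v2) σ (algebraMap (QPoly k I (v1 + v2)) (QFrac k I (v1 + v2)) A /
      algebraMap (QPoly k I (v1 + v2)) (QFrac k I (v1 + v2)) G) =
    algebraMap (QPoly k I (v1 + v2)) (QFrac k I (v1 + v2)) (rename (sE σ) A) /
      algebraMap (QPoly k I (v1 + v2)) (QFrac k I (v1 + v2)) (rename (sE σ) G) :=
  act_div (v := v1 + v2) σ A G

lemma rename_tr {v1 v2 : I → ℕ} (i : I) (a b : Fin (v1 i + v2 i))
    (σ : ∀ i, Equiv.Perm (Fin (v1 i + v2 i))) (P : QPoly k I (v1 + v2)) :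
    rename (sE (fun j => tr i a b j * σ j)) P =
      rename (Equiv.swap (⟨i, a⟩ : QVars I (v1 + v2)) ⟨i, b⟩)
        (rename (sE σ) P) := by
  rw [rename_rename]
  congr 2
  funext x
  exact tr_swap i a b ⟨x.1, σ x.1 x.2⟩

lemma InO_div {R : Type*} [CommRing R] [IsDomain R] {p : R} (A : R) {G : R} (hp : ¬ p ∣ G) :
    InO p (algebraMap R (FractionRing R) A / algebraMap R (FractionRing R) G) := by
  refine ⟨G, hp, A, div_mul_cancel₀ _ ?_⟩
  have : G ≠ 0 := by
    rintro rfl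
    exact hp (dvd_zero p)
  simpa using this

lemma pair_aux {K : Type*} [Field K] {A A' p g g' M : K} (hp : p ≠ 0) (hg : g ≠ 0) (hg' : g' ≠ 0)
    (hM : A * g' - A' * g = p * M) : (A / (p * g) + A' / (-p * g')) * (g * g') = M := by
  field_simp
  linear_combination hM

lemma pair_InO {ι : Type*} [DecidableEq ι] {x y : ι} (hxy : x ≠ y) (A G g : MvPolynomial ι k)
    (hG : G = (X x - X y) * g) (hg : ¬ (X x - X y : MvPolynomial ι k) ∣ g) :
    InO (X x - X y) (algebraMap (MvPolynomial ι k) (FractionRing (MvPolynomial ι k)) A /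
        algebraMap (MvPolynomial ι k) (FractionRing (MvPolynomial ι k)) G +
      algebraMap (MvPolynomial ι k) (FractionRing (MvPolynomial ι k)) (rename (Equiv.swap x y) A) /
        algebraMap (MvPolynomial ι k) (FractionRing (MvPolynomial ι k))
          (rename (Equiv.swap x y) G)) := by
  have hp := prime_sub (k := k) hxy
  have hg' : ¬ (X x - X y : MvPolynomial ι k) ∣ rename (Equiv.swap x y) g :=
    fun h => hg (sub_dvd_rename_swap h)
  have n1 : g ≠ 0 := by rintro rfl; exact hg (dvd_zero _)
  have n2 : rename (Equiv.swap x y) g ≠ 0 := by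
    intro h
    rw [h] at hg'
    exact hg' (dvd_zero _)
  have hG' : rename (Equiv.swap x y) G = -(X x - X y) * rename (Equiv.swap x y) g := by
    rw [hG, map_mul, map_sub, rename_X, rename_X]
    simp
  obtain ⟨M, hM⟩ := sub_dvd_swap x y (A * rename (Equiv.swap x y) g)
  rw [map_mul, rename_swap_swap] at hM
  refine ⟨g * rename (Equiv.swap x y) g, fun h => (hp.dvd_or_dvd h).elim hg hg', M, ?_⟩
  rw [hG', hG, map_mul, map_mul, map_mul, map_neg]
  apply pair_aux
  · exact fun h0 => hp.ne_zero (by simpa [← map_sub] using h0)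
  · simpa using n1
  · simpa using n2
  · rw [← map_mul, ← map_mul, ← map_mul, ← map_sub, hM]

lemma pair_total {ι : Type*} [DecidableEq ι] {v1 v2 : I → ℕ} (e : QVars I (v1 + v2) ≃ ι) {x y : ι}
    (hxy : x ≠ y) (A : MvPolynomial ι k) :
    InO (X x - X y) (algebraMap (MvPolynomial ι k) (FractionRing (MvPolynomial ι k)) A /
        algebraMap (MvPolynomial ι k) (FractionRing (MvPolynomial ι k))
          (rename e (gNegKernel v1 v2)) +
      algebraMap (MvPolynomial ι k) (FractionRing (MvPolynomial ι k)) (rename (Equiv.swap x y) A) /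
        algebraMap (MvPolynomial ι k) (FractionRing (MvPolynomial ι k))
          (rename (Equiv.swap x y) (rename e (gNegKernel v1 v2)))) := by
  have hp := prime_sub (k := k) hxy
  by_cases hd : (X x - X y : MvPolynomial ι k) ∣ rename e (gNegKernel (k := k) v1 v2)
  · obtain ⟨g, j, l, r, h1, h2, h3⟩ := gNeg_dvd e hxy hd
    rcases h3 with ⟨h3, h4⟩ | ⟨h3, h4⟩
    · rw [h3, h4] at h1
      exact pair_InO hxy _ _ g h1 h2
    · rw [h3, h4] at h1
      exact pair_InO hxy _ _ (-g) (by rw [h1]; ring) (by rwa [dvd_neg])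
  · exact (locInt _ hp).add_mem (InO_div _ hd)
      (InO_div _ fun h => hd (sub_dvd_rename_swap h))

lemma shuffle_sum_InO {v1 v2 : I → ℕ} (A : QPoly k I (v1 + v2)) (B : QFrac k I (v1 + v2))
    (hAB : B = algebraMap (QPoly k I (v1 + v2)) (QFrac k I (v1 + v2)) A /
      algebraMap (QPoly k I (v1 + v2)) (QFrac k I (v1 + v2)) (gNegKernel v1 v2)) (hB : BInv B)
    (i : I) (a b : Fin (v1 i + v2 i)) (hab : a ≠ b) :
    InO (X (⟨i, a⟩ : QVars I (v1 + v2)) - X (⟨i, b⟩ : QVars I (v1 + v2)))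
      (∑ σ ∈ shs v1 v2, act (v := v1 + v2) σ B) := by
  have hxy : (⟨i, a⟩ : QVars I (v1 + v2)) ≠ ⟨i, b⟩ := by
    intro h
    apply hab
    simpa using h
  have hp := prime_sub (k := k) hxy
  have key : ∀ σ : ∀ i, Equiv.Perm (Fin (v1 i + v2 i)),
      act (v := v1 + v2) σ B = algebraMap (QPoly k I (v1 + v2)) (QFrac k I (v1 + v2))
          (rename (sE σ) A) /
        algebraMap (QPoly k I (v1 + v2)) (QFrac k I (v1 + v2))
          (rename (sE σ) (gNegKernel v1 v2)) := by
    intro σ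
    rw [hAB]
    exact act_frac σ A (gNegKernel v1 v2)
  change _ ∈ locInt _ hp
  rw [← QuotientAddGroup.eq_zero_iff, ← QuotientAddGroup.mk'_apply, map_sum]
  refine Finset.sum_involution (fun σ _ => rd (fun j => tr i a b j * σ j)) ?_ ?_ ?_ ?_
  · intro σ hσ
    rw [← map_add, QuotientAddGroup.mk'_apply, QuotientAddGroup.eq_zero_iff, act_rd hB, key, key,
      rename_tr, rename_tr]
    have hfin := pair_total (v1 := v1) (v2 := v2) (sE σ) hxy (rename (sE σ) A)
    generalize rename (sE σ) A = A1 at hfin ⊢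
    generalize rename (sE σ) (gNegKernel (k := k) v1 v2) = G1 at hfin ⊢
    exact hfin
  · intro σ hσ hne he
    apply hne
    rw [QuotientAddGroup.mk'_apply, QuotientAddGroup.eq_zero_iff, key]
    apply InO_div
    intro hd
    obtain ⟨g, j, l, r, h1, h2, h3⟩ := gNeg_dvd (sE σ) hxy hd
    obtain ⟨η1, η2, hη⟩ := rd_spec (fun j => tr i a b j * σ j)
    rw [he] at hη
    have h5 : Equiv.swap (⟨i, a⟩ : QVars I (v1 + v2)) ⟨i, b⟩
        (⟨j, σ j (Fin.castAdd (v2 j) l)⟩ : QVars I (v1 + v2)) =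
        (⟨j, σ j (Fin.natAdd (v1 j) r)⟩ : QVars I (v1 + v2)) := by
      rcases h3 with ⟨h3, h4⟩ | ⟨h3, h4⟩
      · refine (congrArg _ h3).trans ((Equiv.swap_apply_left _ _).trans h4.symm)
      · refine (congrArg _ h3).trans ((Equiv.swap_apply_right _ _).trans h4.symm)
    rw [← tr_swap] at h5
    have h6 : tr i a b j (σ j (Fin.castAdd (v2 j) l)) = σ j (Fin.natAdd (v1 j) r) :=
      eq_of_heq (Sigma.mk.inj h5).2
    have h7 := congrArg (fun f => f (Fin.castAdd (v2 j) l)) (congrFun hη j)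
    simp only [Equiv.Perm.mul_apply, blk_castAdd] at h7
    rw [h6] at h7
    have h8 := congrArg Fin.val ((σ j).injective h7)
    simp only [Fin.val_castAdd, Fin.val_natAdd] at h8
    have := (η1 j l).2
    omega
  · intro σ hσ
    exact rd_mem _
  · intro σ hσ
    exact rd_rd hσ _ _ (tr_tr i a b)

/-- The differences of variables at a common vertex. -/
def diffs (k : Type*) [CommRing k] (v : I → ℕ) : Set (QPoly k I v) :=
  {p | ∃ (i : I) (a b : Fin (v i)), a ≠ b ∧ p = X (⟨i, a⟩ : QVars I v) - X (⟨i, b⟩ : QVars I v)}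

lemma clears_gNeg {v1 v2 : I → ℕ} (σ : ∀ i, Equiv.Perm (Fin (v1 i + v2 i))) :
    Clears (diffs k (v1 + v2))
      (rename (sE σ) (gNegKernel (k := k) v1 v2)) := by
  rw [rename_gNeg]
  unfold gK
  refine Finset.prod_induction _ _ (fun _ _ => Clears.mul) (Clears.one _) fun i _ => ?_
  refine Finset.prod_induction _ _ (fun _ _ => Clears.mul) (Clears.one _) fun l _ => ?_
  refine Finset.prod_induction _ _ (fun _ _ => Clears.mul) (Clears.one _) fun r _ => ?_
  have hne : σ i (Fin.castAdd (v2 i) l) ≠ σ i (Fin.natAdd (v1 i) r) := by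
    intro h
    have := congrArg Fin.val ((σ i).injective h)
    simp only [Fin.val_castAdd, Fin.val_natAdd] at this
    omega
  apply Clears.prime
  · apply prime_sub
    intro h
    exact hne (eq_of_heq (Sigma.mk.inj h).2)
  · exact ⟨i, _, _, hne, rfl⟩

lemma common_denom {R α : Type*} [CommRing R] [IsDomain R] (s : Finset α) (N D : α → R)
    (hD : ∀ x ∈ s, D x ≠ 0) :
    ∃ M, (∑ x ∈ s, algebraMap R (FractionRing R) (N x) / algebraMap R (FractionRing R) (D x)) *
      algebraMap R (FractionRing R) (∏ x ∈ s, D x) = algebraMap R (FractionRing R) M := by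
  refine ⟨∑ x ∈ s, N x * ∏ y ∈ s.erase x, D y, ?_⟩
  rw [Finset.sum_mul, map_sum]
  refine Finset.sum_congr rfl fun x hx => ?_
  have : algebraMap R (FractionRing R) (D x) ≠ 0 := by simpa using hD x hx
  rw [← Finset.mul_prod_erase s D hx, map_mul, map_mul]
  field_simp

lemma shuffle_sum_poly {v1 v2 : I → ℕ} (A : QPoly k I (v1 + v2)) (B : QFrac k I (v1 + v2))
    (hAB : B = algebraMap (QPoly k I (v1 + v2)) (QFrac k I (v1 + v2)) A /
      algebraMap (QPoly k I (v1 + v2)) (QFrac k I (v1 + v2)) (gNegKernel v1 v2)) (hB : BInv B) :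
    ∃ g, ∑ σ ∈ shs v1 v2, act (v := v1 + v2) σ B =
      algebraMap (QPoly k I (v1 + v2)) (QFrac k I (v1 + v2)) g := by
  have hcl : Clears (diffs k (v1 + v2)) (∏ σ ∈ shs v1 v2,
      (rename (sE σ) (gNegKernel (k := k) v1 v2))) :=
    Finset.prod_induction _ _ (fun _ _ => Clears.mul) (Clears.one _) fun σ _ => clears_gNeg σ
  refine hcl _ ?_ ?_
  · rintro p ⟨i, a, b, hab, rfl⟩
    exact shuffle_sum_InO A B hAB hB i a b hab
  · have hg : gNegKernel (k := k) v1 v2 ≠ 0 := by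
      unfold gNegKernel
      refine Finset.prod_ne_zero_iff.2 fun i _ => Finset.prod_ne_zero_iff.2 fun l _ =>
        Finset.prod_ne_zero_iff.2 fun r _ => ?_
      apply Prime.ne_zero
      apply prime_sub
      intro h
      have := congrArg Fin.val (eq_of_heq (Sigma.mk.inj h).2)
      simp only [Fin.val_castAdd, Fin.val_natAdd] at this
      omega
    obtain ⟨M, hM⟩ := common_denom (shs v1 v2)
      (fun σ => rename (sE σ) A)
      (fun σ => rename (sE σ) (gNegKernel (k := k) v1 v2))
      (fun σ _ h => hg (rename_injective _ (Equiv.injective _) (h.trans (map_zero _).symm)))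
    refine ⟨M, ?_⟩
    rw [← hM]
    congr 1
    refine Finset.sum_congr rfl fun σ _ => ?_
    rw [hAB]
    exact act_frac σ A (gNegKernel v1 v2)

lemma coha_poly (Q : I → I → ℕ) (h : k) (v1 v2 w1 w2 : I → ℕ)
    (u1 : ∀ i, Fin (w1 i) → k) (u2 : ∀ i, Fin (w2 i) → k)
    (f1 : QPoly k I v1) (hf1 : VertexSymm f1)
    (f2 : QPoly k I v2) (hf2 : VertexSymm f2) :
    ∃ g : QPoly k I (v1 + v2), VertexSymm g ∧
      algebraMap (QPoly k I (v1 + v2)) (QFrac k I (v1 + v2)) g =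
        cohaMul Q h v1 v2 w1 w2 u1 u2 f1 f2 := by
  have hB : BInv (bTerm Q h v1 v2 w1 w2 u1 u2 f1 f2) := by
    intro η1 η2
    rw [bTerm_symm, hf1, hf2]
  rw [cohaMul_eq]
  obtain ⟨g, hg⟩ := shuffle_sum_poly _ (bTerm Q h v1 v2 w1 w2 u1 u2 f1 f2) rfl hB
  refine ⟨g, ?_, hg.symm⟩
  intro τ
  apply IsFractionRing.injective (QPoly k I (v1 + v2)) (QFrac k I (v1 + v2))
  have := shuffle_sum_symm hB τ
  rw [hg] at this
  rw [← this]
  exact (qFracMap_algebraMap _ _ _).symm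
/-- for `f1, f2` symmetric in each group of variables, the framed CoHA shuffle
product `m(f1,f2) = Shuffle(e(T*Rep(v,w)[-1])·f1·f2 / e(g_v[-1]))` is (the image of) a
polynomial symmetric in each full group of vertex variables; moreover the operation is
associative: if `g12` and `g23` are polynomial representatives of `m(f1,f2)` and `m(f2,f3)`
then `m(g12, f3)` and `m(f1, g23)` agree under the canonical identification
`(v1+v2)+v3 = v1+(v2+v3)` of the variables (with concatenated framing parameters). -/
theorem framed_coha_shuffle_polynomiality_and_assoc
    (Q : I → I → ℕ) (h : k) (v1 v2 w1 w2 : I → ℕ)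
    (u1 : ∀ i, Fin (w1 i) → k) (u2 : ∀ i, Fin (w2 i) → k)
    (f1 : QPoly k I v1) (hf1 : VertexSymm f1)
    (f2 : QPoly k I v2) (hf2 : VertexSymm f2) :
    (∃ g : QPoly k I (v1 + v2), VertexSymm g ∧
      algebraMap (QPoly k I (v1 + v2)) (QFrac k I (v1 + v2)) g =
        cohaMul Q h v1 v2 w1 w2 u1 u2 f1 f2) ∧
    (∀ (v3 w3 : I → ℕ) (u3 : ∀ i, Fin (w3 i) → k)
      (f3 : QPoly k I v3) (_ : VertexSymm f3)
      (g12 : QPoly k I (v1 + v2)) (_ : VertexSymm g12)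
      (g23 : QPoly k I (v2 + v3)) (_ : VertexSymm g23)
      (_ : algebraMap (QPoly k I (v1 + v2)) (QFrac k I (v1 + v2)) g12 =
        cohaMul Q h v1 v2 w1 w2 u1 u2 f1 f2)
      (_ : algebraMap (QPoly k I (v2 + v3)) (QFrac k I (v2 + v3)) g23 =
        cohaMul Q h v2 v3 w2 w3 u2 u3 f2 f3),
      qFracMap
          (⇑(Equiv.sigmaCongrRight (fun i : I => finCongr (Nat.add_assoc (v1 i) (v2 i) (v3 i)))))
          (Equiv.sigmaCongrRight (fun i : I =>
            finCongr (Nat.add_assoc (v1 i) (v2 i) (v3 i)))).injective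
          (cohaMul Q h (v1 + v2) v3 (w1 + w2) w3
            (fun i => Fin.append (u1 i) (u2 i)) u3 g12 f3) =
        cohaMul Q h v1 (v2 + v3) w1 (w2 + w3)
          u1 (fun i => Fin.append (u2 i) (u3 i)) f1 g23) := by

  refine ⟨coha_poly Q h v1 v2 w1 w2 u1 u2 f1 hf1 f2 hf2, ?_⟩
  intro v3 w3 u3 f3 _ g12 _ g23 _ h12 h23
  exact coha_assoc Q h v1 v2 w1 w2 u1 u2 f1 f2 v3 w3 u3 f3 g12 g23 h12 h23
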